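/- arXiv:1507.02048 — 4 statements merged into one kernel-verified Lean document; each statement's English description precedes it below -/
import Mathlib

section
/- Let m ≥ 1 and let A*, B_1, …, B_m, D_1, …, D_m, C_1, …, C_m, OPA_1, …, OPA_m be finite sets such that (i) Σ_{i=1}^m |B_i| + |⋃_{i=1}^m D_i| = |A*|, and (ii) |B_i ∪ D_i| ≥ |C_i| for every 1 ≤ i ≤ m. Suppose A* is nonempty and every C_i is nonempty, and define r_i = |OPA_i| / |C_i|, r_max = max_{1≤i≤m} r_i, and ε̄ = m · (max_{1≤i≤m} |D_i|) / |A*|. Then Σ_{i=1}^m |OPA_i| / |A*| ≤ (1 + ε̄) · r_max. -/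
/-- Combinatorial core of Lemma 1 (approximation ratio of LSAA):
`Astar` is a minimum set cover, `B i` the non-bridge part covering group `i`,
`D i` the bridges of group `i`, `C i` a minimum set cover of group `i`,
`OPA i` the local algorithm's set cover of group `i`. -/
theorem stmt_0 {α : Type*} [DecidableEq α] (m : ℕ) (hm : 1 ≤ m)
    (Astar : Finset α) (B D C OPA : Fin m → Finset α)
    (h1 : ∑ i, (B i).card + (Finset.univ.biUnion D).card = Astar.card)
    (h2 : ∀ i, (C i).card ≤ (B i ∪ D i).card)
    (hA : Astar.Nonempty) (hC : ∀ i, (C i).Nonempty)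
    (r : Fin m → ℝ) (hr : ∀ i, r i = ((OPA i).card : ℝ) / ((C i).card : ℝ))
    (rmax : ℝ)
    (hrmax : rmax = Finset.univ.sup' ⟨⟨0, hm⟩, Finset.mem_univ _⟩ r)
    (ε : ℝ)
    (hε : ε = (m : ℝ) *
        (Finset.univ.sup' ⟨⟨0, hm⟩, Finset.mem_univ _⟩ fun i => ((D i).card : ℝ)) /
        (Astar.card : ℝ)) :
    (∑ i, ((OPA i).card : ℝ)) / (Astar.card : ℝ) ≤ (1 + ε) * rmax := by
  have hA0 : (0 : ℝ) < Astar.card := by exact_mod_cast hA.card_pos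
  set d : ℝ := Finset.univ.sup' ⟨⟨0, hm⟩, Finset.mem_univ _⟩ fun i => ((D i).card : ℝ) with hd
  have hD (i) : ((D i).card : ℝ) ≤ d :=
    Finset.le_sup' (fun i => ((D i).card : ℝ)) (Finset.mem_univ i)
  have hrle (i) : r i ≤ rmax := hrmax ▸ Finset.le_sup' r (Finset.mem_univ i)
  have hrmax0 : 0 ≤ rmax := le_trans (by rw [hr]; positivity) (hrle ⟨0, hm⟩)
  have hOPA (i) : ((OPA i).card : ℝ) ≤ rmax * (C i).card := by
    have hC0 : (0 : ℝ) < (C i).card := by exact_mod_cast (hC i).card_pos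
    rw [← div_le_iff₀ hC0, ← hr]
    exact hrle i
  have hCle (i) : ((C i).card : ℝ) ≤ (B i).card + d := by
    have hBD : ((C i).card : ℝ) ≤ (B i).card + (D i).card := by
      exact_mod_cast (h2 i).trans (Finset.card_union_le _ _)
    linarith [hD i]
  have hB : ∑ i, ((B i).card : ℝ) ≤ Astar.card := by
    exact_mod_cast h1 ▸ Nat.le_add_right _ _
  have hε' : (1 + ε) * rmax * Astar.card = rmax * (Astar.card + m * d) := by
    rw [hε]
    field_simp
  rw [div_le_iff₀ hA0, hε']
  calc ∑ i, ((OPA i).card : ℝ)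
      ≤ ∑ i, rmax * ((B i).card + d) := Finset.sum_le_sum fun i _ =>
        (hOPA i).trans (mul_le_mul_of_nonneg_left (hCle i) hrmax0)
    _ = rmax * (∑ i, ((B i).card : ℝ) + m * d) := by
        simp [← Finset.mul_sum, Finset.sum_add_distrib]
    _ ≤ rmax * (Astar.card + m * d) := by gcongr
end

section
/- Work in the Euclidean plane EuclideanSpace ℝ (Fin 2). Let x_i and x_j be points and r > 0 with 0 < dist(x_i, x_j) ≤ 2r, and define the intersection arc of the two discs of radius r centered at x_i and x_j as the set A = {p : (dist(p, x_i) = r and dist(p, x_j) ≤ r) or (dist(p, x_j) = r and dist(p, x_i) ≤ r)}. Let S be a point with dist(S, x_j) > r, and set H = x_j + (r / dist(S, x_j)) • (S − x_j) (the intersection of the segment from x_j to S with the circle of radius r centered at x_j). If dist(H, x_i) ≤ r (so that H lies on the intersection arc), then for every point p ∈ A one has dist(S, H) ≤ dist(S, p); that is, H is a nearest point to S on the intersection arc. -/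
/-- The radial projection of `x` onto the sphere of radius `r` about `c` is at distance
`dist x c - r` from `x`, when `x` lies outside the open ball. -/
theorem dist_add_smul_sub_eq_dist_sub {E : Type*} [NormedAddCommGroup E] [NormedSpace ℝ E]
    {c x : E} {r : ℝ} (h : r ≤ dist x c) (hx : 0 < dist x c) :
    dist x (c + (r / dist x c) • (x - c)) = dist x c - r := by
  have hsub : x - (c + (r / dist x c) • (x - c)) = (1 - r / dist x c) • (x - c) := by
    module
  have hnonneg : 0 ≤ 1 - r / dist x c := sub_nonneg.2 ((div_le_one hx).2 h)
  rw [dist_eq_norm x (_ + _), hsub, norm_smul, Real.norm_of_nonneg hnonneg, ← dist_eq_norm]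
  field_simp


/-- Lemma 3: if the segment from `x_j` to the sink `S` crosses the
intersection arc of the two discs at `H`, then `H` is a nearest point to `S`
on the intersection arc. -/
theorem stmt_5 (xi xj S : EuclideanSpace ℝ (Fin 2)) (r : ℝ) (hr : 0 < r)
    (hd : 0 < dist xi xj) (hd2 : dist xi xj ≤ 2 * r)
    (hS : r < dist S xj)
    (H : EuclideanSpace ℝ (Fin 2))
    (hH : H = xj + (r / dist S xj) • (S - xj))
    (hHarc : dist H xi ≤ r) :
    ∀ p : EuclideanSpace ℝ (Fin 2),
      ((dist p xi = r ∧ dist p xj ≤ r) ∨ (dist p xj = r ∧ dist p xi ≤ r)) →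
      dist S H ≤ dist S p := by
  intro p hp
  have hp' : dist p xj ≤ r := hp.elim And.right fun h => h.1.le
  rw [hH, dist_add_smul_sub_eq_dist_sub hS.le (hr.trans hS)]
  linarith [dist_triangle S p xj]
end

section
/- Work in the Euclidean plane EuclideanSpace ℝ (Fin 2). Let x_i and x_j be points and r > 0 with 0 < dist(x_i, x_j) < 2r, and define the intersection arc of the two discs of radius r centered at x_i and x_j as the set A = {p : (dist(p, x_i) = r and dist(p, x_j) ≤ r) or (dist(p, x_j) = r and dist(p, x_i) ≤ r)}. Let S be a point with dist(S, x_i) > r and dist(S, x_j) > r, and set H_i = x_i + (r / dist(S, x_i)) • (S − x_i) and H_j = x_j + (r / dist(S, x_j)) • (S − x_j). If dist(H_i, x_j) > r and dist(H_j, x_i) > r (i.e., neither segment from a disc center to S meets the intersection arc), then there exists a point c with dist(c, x_i) = r and dist(c, x_j) = r (an intersection point of the two boundary circles) such that dist(S, c) ≤ dist(S, p) for every p ∈ A; that is, the nearest point to S on the intersection arc is one of the two intersection points of the two circles. -/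
lemma EuclideanSpace.dist_sq_fin_two (p q : EuclideanSpace ℝ (Fin 2)) :
    dist p q ^ 2 = (p 0 - q 0) ^ 2 + (p 1 - q 1) ^ 2 := by
  rw [EuclideanSpace.dist_sq_eq, Fin.sum_univ_two, Real.dist_eq, Real.dist_eq, sq_abs, sq_abs]

/-- On the part `h ≤ x` of the circle through `(h, k)` centered at the origin, the linear form
`(a, b)` is largest at `(h, k)`, provided `(a, b)` lies on the same side as `(h, k)` of the first
axis and, if `0 < a`, is at least as steep as `(h, k)`. -/
lemma linear_form_le_at_arc_endpoint {a b x y h k : ℝ} (hh : 0 ≤ h) (hk : k ≠ 0)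
    (hkb : 0 ≤ k * b) (hab : 0 < a → k ^ 2 * a ^ 2 ≤ h ^ 2 * b ^ 2)
    (hxy : x ^ 2 + y ^ 2 = h ^ 2 + k ^ 2) (hx : h ≤ x) :
    a * x + b * y ≤ a * h + b * k := by
  have hk2 : 0 < k ^ 2 := by positivity
  have slope : k ^ 2 * a ≤ h * (k * b) := by
    rcases le_or_gt a 0 with ha | ha
    · exact (mul_nonpos_of_nonneg_of_nonpos hk2.le ha).trans (mul_nonneg hh hkb)
    · refine (abs_le_of_sq_le_sq' ?_ (mul_nonneg hh hkb)).2
      calc (k ^ 2 * a) ^ 2 = k ^ 2 * (k ^ 2 * a ^ 2) := by ring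
        _ ≤ k ^ 2 * (h ^ 2 * b ^ 2) := mul_le_mul_of_nonneg_left (hab ha) hk2.le
        _ = (h * (k * b)) ^ 2 := by ring
  have cs : h * x + k * y ≤ h ^ 2 + k ^ 2 := by nlinarith [sq_nonneg (h - x), sq_nonneg (k - y)]
  have h1 := mul_le_mul_of_nonneg_right slope (sub_nonneg.2 hx)
  have h2 := mul_le_mul_of_nonneg_left cs hkb
  refine le_of_mul_le_mul_left ?_ hk2
  linarith

/-- If the segment from `u` to `S` leaves the disc of radius `r` about `u` outside the disc of
radius `r` about `v`, then among the points of the circle about `u` inside the disc about `v`, the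
nearest to `S` is the intersection point `c` of the two circles on the same side as `S`. -/
lemma dist_le_dist_of_mem_arc {u v S c p : EuclideanSpace ℝ (Fin 2)} {r : ℝ} (hr : 0 < r)
    (hS : r < dist S u) (hH : r < dist (u + (r / dist S u) • (S - u)) v)
    (hcu : dist c u = r) (hcv : dist c v = r)
    (hc : (c 1 - u 1) * (v 0 - u 0) - (c 0 - u 0) * (v 1 - u 1) ≠ 0)
    (hcS : 0 ≤ ((c 1 - u 1) * (v 0 - u 0) - (c 0 - u 0) * (v 1 - u 1)) *
      ((S 1 - u 1) * (v 0 - u 0) - (S 0 - u 0) * (v 1 - u 1)))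
    (hpu : dist p u = r) (hpv : dist p v ≤ r) : dist S c ≤ dist S p := by
  have hL : 0 < dist S u := hr.trans hS
  have hL2 := EuclideanSpace.dist_sq_fin_two S u
  have hH2 := pow_lt_pow_left₀ hH hr.le two_ne_zero
  have hpv2 := pow_le_pow_left₀ dist_nonneg hpv 2
  have hcu2 := EuclideanSpace.dist_sq_fin_two c u
  have hcv2 := EuclideanSpace.dist_sq_fin_two c v
  have hpu2 := EuclideanSpace.dist_sq_fin_two p u
  rw [EuclideanSpace.dist_sq_fin_two] at hH2 hpv2
  rw [hcu] at hcu2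
  rw [hcv] at hcv2
  rw [hpu] at hpu2
  simp only [PiLp.add_apply, PiLp.smul_apply, PiLp.sub_apply, smul_eq_mul] at hH2
  refine (abs_le_of_sq_le_sq' ?_ dist_nonneg).2
  rw [EuclideanSpace.dist_sq_fin_two, EuclideanSpace.dist_sq_fin_two]
  generalize dist S u = L at *
  obtain ⟨t, ht⟩ : ∃ t, t = r / L := ⟨_, rfl⟩
  have htL : t * L = r := by rw [ht]; field_simp
  rw [← ht] at hH2
  clear ht hH
  -- coordinates relative to `u`
  obtain ⟨d0, hd0⟩ : ∃ z, z = v 0 - u 0 := ⟨_, rfl⟩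
  obtain ⟨d1, hd1⟩ : ∃ z, z = v 1 - u 1 := ⟨_, rfl⟩
  obtain ⟨s0, hs0⟩ : ∃ z, z = S 0 - u 0 := ⟨_, rfl⟩
  obtain ⟨s1, hs1⟩ : ∃ z, z = S 1 - u 1 := ⟨_, rfl⟩
  obtain ⟨c0, hc0⟩ : ∃ z, z = c 0 - u 0 := ⟨_, rfl⟩
  obtain ⟨c1, hc1⟩ : ∃ z, z = c 1 - u 1 := ⟨_, rfl⟩
  obtain ⟨p0, hp0⟩ : ∃ z, z = p 0 - u 0 := ⟨_, rfl⟩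
  obtain ⟨p1, hp1⟩ : ∃ z, z = p 1 - u 1 := ⟨_, rfl⟩
  rw [show c 0 - v 0 = c0 - d0 by linarith, show c 1 - v 1 = c1 - d1 by linarith] at hcv2
  rw [show p 0 - v 0 = p0 - d0 by linarith, show p 1 - v 1 = p1 - d1 by linarith] at hpv2
  rw [show u 0 + t * (S 0 - u 0) - v 0 = t * s0 - d0 by rw [hs0]; linarith,
    show u 1 + t * (S 1 - u 1) - v 1 = t * s1 - d1 by rw [hs1]; linarith] at hH2
  rw [show S 0 - c 0 = s0 - c0 by linarith, show S 1 - c 1 = s1 - c1 by linarith,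
    show S 0 - p 0 = s0 - p0 by linarith, show S 1 - p 1 = s1 - p1 by linarith]
  simp only [← hd0, ← hd1, ← hs0, ← hs1, ← hc0, ← hc1, ← hp0, ← hp1] at *
  clear hd0 hd1 hs0 hs1 hc0 hc1 hp0 hp1
  have hD : 0 < d0 ^ 2 + d1 ^ 2 := by
    by_contra! hD
    exact hc (by rw [show d0 = 0 by nlinarith, show d1 = 0 by nlinarith]; ring)
  have hcd : c0 * d0 + c1 * d1 = (d0 ^ 2 + d1 ^ 2) / 2 := by linarith
  have hpd : (d0 ^ 2 + d1 ^ 2) / 2 ≤ p0 * d0 + p1 * d1 := by linarith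
  have hts : t * (s0 * d0 + s1 * d1) < (d0 ^ 2 + d1 ^ 2) / 2 := by
    have : t ^ 2 * (s0 ^ 2 + s1 ^ 2) = r ^ 2 := by rw [← hL2, ← htL]; ring
    nlinarith
  have key := linear_form_le_at_arc_endpoint (a := s0 * d0 + s1 * d1) (b := s1 * d0 - s0 * d1)
    (x := p0 * d0 + p1 * d1) (y := p1 * d0 - p0 * d1) (h := c0 * d0 + c1 * d1)
    (k := c1 * d0 - c0 * d1) (by linarith) hc hcS ?_ ?_ (by linarith)
  · have : (d0 ^ 2 + d1 ^ 2) * (s0 * p0 + s1 * p1) ≤ (d0 ^ 2 + d1 ^ 2) * (s0 * c0 + s1 * c1) := by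
      linarith
    have := le_of_mul_le_mul_left this hD
    linarith
  · intro ha
    have h1 : r * (s0 * d0 + s1 * d1) ≤ (c0 * d0 + c1 * d1) * L := by
      rw [hcd, ← htL]; nlinarith
    have h2 := pow_le_pow_left₀ (by positivity) h1 2
    rw [mul_pow, mul_pow, hL2, hcu2] at h2
    have h3 := mul_le_mul_of_nonneg_left h2 hD.le
    linarith
  · linear_combination (d0 ^ 2 + d1 ^ 2) * (hcu2 - hpu2)

/-- Lemma 4: if neither segment from a disc center to the sink `S` meets the
intersection arc, then a nearest point to `S` on the intersection arc is one
of the two intersection points of the two boundary circles. -/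
theorem stmt_6 (xi xj S : EuclideanSpace ℝ (Fin 2)) (r : ℝ) (hr : 0 < r)
    (hd : 0 < dist xi xj) (hd2 : dist xi xj < 2 * r)
    (hSi : r < dist S xi) (hSj : r < dist S xj)
    (Hi Hj : EuclideanSpace ℝ (Fin 2))
    (hHi : Hi = xi + (r / dist S xi) • (S - xi))
    (hHj : Hj = xj + (r / dist S xj) • (S - xj))
    (hHi' : r < dist Hi xj) (hHj' : r < dist Hj xi) :
    ∃ c : EuclideanSpace ℝ (Fin 2), dist c xi = r ∧ dist c xj = r ∧
      ∀ p : EuclideanSpace ℝ (Fin 2),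
        ((dist p xi = r ∧ dist p xj ≤ r) ∨ (dist p xj = r ∧ dist p xi ≤ r)) →
        dist S c ≤ dist S p := by
  subst hHi hHj
  have hd2' := pow_lt_pow_left₀ hd2 hd.le two_ne_zero
  have hD := EuclideanSpace.dist_sq_fin_two xi xj
  have hD0 : 0 < dist xi xj ^ 2 := by positivity
  generalize dist xi xj ^ 2 = D at *
  obtain ⟨l, hl, hlS⟩ : ∃ l : ℝ, l ^ 2 = r ^ 2 / D - 1 / 4 ∧
      0 ≤ l * ((S 1 - xi 1) * (xj 0 - xi 0) - (S 0 - xi 0) * (xj 1 - xi 1)) := by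
    have hpos : 0 ≤ r ^ 2 / D - 1 / 4 := by
      rw [sub_nonneg, le_div_iff₀ hD0]; linarith
    rcases le_total 0 ((S 1 - xi 1) * (xj 0 - xi 0) - (S 0 - xi 0) * (xj 1 - xi 1)) with h | h
    · exact ⟨√(r ^ 2 / D - 1 / 4), Real.sq_sqrt hpos, mul_nonneg (Real.sqrt_nonneg _) h⟩
    · exact ⟨-√(r ^ 2 / D - 1 / 4), by rw [neg_sq, Real.sq_sqrt hpos],
        mul_nonneg_of_nonpos_of_nonpos (neg_nonpos.2 (Real.sqrt_nonneg _)) h⟩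
  have hlD : l ^ 2 * D + D / 4 = r ^ 2 := by rw [hl]; field_simp; ring
  have hl0 : l ≠ 0 := by
    rintro rfl
    linarith
  obtain ⟨c, hc0, hc1⟩ : ∃ c : EuclideanSpace ℝ (Fin 2),
      c 0 = (xi 0 + xj 0) / 2 - l * (xj 1 - xi 1) ∧ c 1 = (xi 1 + xj 1) / 2 + l * (xj 0 - xi 0) :=
    ⟨!₂[_, _], rfl, rfl⟩
  have hci : dist c xi = r := by
    rw [← sq_eq_sq₀ dist_nonneg hr.le, EuclideanSpace.dist_sq_fin_two, hc0, hc1, ← hlD, hD]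
    ring
  have hcj : dist c xj = r := by
    rw [← sq_eq_sq₀ dist_nonneg hr.le, EuclideanSpace.dist_sq_fin_two, hc0, hc1, ← hlD, hD]
    ring
  have hki : (c 1 - xi 1) * (xj 0 - xi 0) - (c 0 - xi 0) * (xj 1 - xi 1) = D * l := by
    rw [hc0, hc1, hD]; ring
  have hkj : (c 1 - xj 1) * (xi 0 - xj 0) - (c 0 - xj 0) * (xi 1 - xj 1) = -(D * l) := by
    rw [hc0, hc1, hD]; ring
  have hDl : D * l ≠ 0 := mul_ne_zero hD0.ne' hl0
  have hDlS := mul_nonneg hD0.le hlS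
  refine ⟨c, hci, hcj, fun p hp => ?_⟩
  rcases hp with ⟨hpi, hpj⟩ | ⟨hpj, hpi⟩
  · exact dist_le_dist_of_mem_arc hr hSi hHi' hci hcj (hki ▸ hDl) (by rw [hki]; linarith) hpi hpj
  · exact dist_le_dist_of_mem_arc hr hSj hHj' hcj hci (hkj ▸ neg_ne_zero.2 hDl)
      (by rw [hkj]; linarith) hpj hpi
end

section
/- Work in the Euclidean plane EuclideanSpace ℝ (Fin 2). Let X be a finite set of n points (the sensor node locations) and r > 0. Then the collection of nonempty subsets of X of the form {x ∈ X : dist(x, p) ≤ r} for some point p of the plane has cardinality at most n(n + 1). -/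
open Filter Topology

/-- The power of the point `p` with respect to the circle of radius `r` centred at `x`. -/
def circlePower (r : ℝ) (x p : EuclideanSpace ℝ (Fin 2)) : ℝ :=
  (p 0 - x 0) ^ 2 + (p 1 - x 1) ^ 2 - r ^ 2

/-- The points lying in all closed disks centred in `F` and in no open disk centred in `X \ F`. -/
def diskCell (X : Finset (EuclideanSpace ℝ (Fin 2))) (r : ℝ)
    (F : Finset (EuclideanSpace ℝ (Fin 2))) : Set (EuclideanSpace ℝ (Fin 2)) :=
  {p | ∀ x ∈ X, (x ∈ F → circlePower r x p ≤ 0) ∧ (x ∉ F → 0 ≤ circlePower r x p)}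

/-- `q` is a point of least height in the cell of `F`. -/
def IsLowest (X : Finset (EuclideanSpace ℝ (Fin 2))) (r : ℝ)
    (F : Finset (EuclideanSpace ℝ (Fin 2))) (q : EuclideanSpace ℝ (Fin 2)) : Prop :=
  q ∈ diskCell X r F ∧ ∀ p ∈ diskCell X r F, q 1 ≤ p 1

/-- The circles of radius `r` centred in `X` are in general position: no two are tangent, no two
meet at the top or bottom of one of them, and no three are concurrent. -/
structure GenericRadius (X : Finset (EuclideanSpace ℝ (Fin 2))) (r : ℝ) : Prop where
  not_tangent : ∀ x ∈ X, ∀ y ∈ X, x ≠ y → (x 0 - y 0) ^ 2 + (x 1 - y 1) ^ 2 ≠ 4 * r ^ 2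
  not_extremal : ∀ x ∈ X, ∀ y ∈ X, x ≠ y → ∀ q, circlePower r x q = 0 →
    circlePower r y q = 0 → q 0 ≠ x 0
  not_concurrent : ∀ x ∈ X, ∀ y ∈ X, ∀ z ∈ X, x ≠ y → x ≠ z → y ≠ z → ∀ q,
    circlePower r x q = 0 → circlePower r y q = 0 → circlePower r z q ≠ 0

theorem plane_ext {x y : EuclideanSpace ℝ (Fin 2)} (h0 : x 0 = y 0) (h1 : x 1 = y 1) : x = y := by
  ext i
  fin_cases i
  · exact h0
  · exact h1

theorem sq_add_sq_ne_zero_of_ne {x y : EuclideanSpace ℝ (Fin 2)} (h : x ≠ y) :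
    (x 0 - y 0) ^ 2 + (x 1 - y 1) ^ 2 ≠ 0 := by
  intro h'
  have e0 : x 0 - y 0 = 0 := by nlinarith [sq_nonneg (x 0 - y 0), sq_nonneg (x 1 - y 1)]
  have e1 : x 1 - y 1 = 0 := by nlinarith [sq_nonneg (x 0 - y 0), sq_nonneg (x 1 - y 1)]
  exact h (plane_ext (by linarith) (by linarith))

theorem dist_sq_eq_circlePower (r : ℝ) (x p : EuclideanSpace ℝ (Fin 2)) :
    dist x p ^ 2 = circlePower r x p + r ^ 2 := by
  rw [EuclideanSpace.dist_eq, Real.sq_sqrt (by positivity), Fin.sum_univ_two, Real.dist_eq,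
    Real.dist_eq, sq_abs, sq_abs, circlePower]
  ring

theorem continuous_circlePower (r : ℝ) (x : EuclideanSpace ℝ (Fin 2)) :
    Continuous (circlePower r x) := by
  unfold circlePower
  fun_prop

theorem circlePower_nonpos_iff {r : ℝ} (hr : 0 < r) (x p : EuclideanSpace ℝ (Fin 2)) :
    circlePower r x p ≤ 0 ↔ dist x p ≤ r := by
  rw [← sq_le_sq₀ dist_nonneg hr.le, dist_sq_eq_circlePower r]
  constructor <;> intro h <;> linarith

theorem exists_isLowest {X F : Finset (EuclideanSpace ℝ (Fin 2))} {r : ℝ} (hr : 0 < r)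
    (hFX : F ⊆ X) (hF : F.Nonempty) (hne : (diskCell X r F).Nonempty) :
    ∃ q, IsLowest X r F q := by
  obtain ⟨x, hx⟩ := hF
  have hclosed : IsClosed (diskCell X r F) := by
    simp only [diskCell, Set.ofPred_forall, Set.ofPred_and]
    refine isClosed_biInter fun y _ => IsClosed.inter ?_ ?_
    · exact isClosed_iInter fun _ => isClosed_le (continuous_circlePower r y) continuous_const
    · exact isClosed_iInter fun _ => isClosed_le continuous_const (continuous_circlePower r y)
  have hcompact : IsCompact (diskCell X r F) := by
    refine (isCompact_closedBall x r).of_isClosed_subset hclosed fun p hp => ?_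
    rw [Metric.mem_closedBall, dist_comm]
    exact (circlePower_nonpos_iff hr x p).1 ((hp x (hFX hx)).1 hx)
  obtain ⟨q, hq, hmin⟩ := hcompact.exists_isMinOn hne
    (f := fun p : EuclideanSpace ℝ (Fin 2) => p 1) (by fun_prop)
  exact ⟨q, hq, fun p hp => hmin hp⟩

/-- No downward direction points strictly into the cell at a lowest point. -/
theorem IsLowest.exists_blocking {X F : Finset (EuclideanSpace ℝ (Fin 2))} {r : ℝ}
    {q : EuclideanSpace ℝ (Fin 2)} (hq : IsLowest X r F q) (u v : ℝ) (hv : v < 0) :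
    ∃ x ∈ X, circlePower r x q = 0 ∧
      (x ∈ F → 0 ≤ (q 0 - x 0) * u + (q 1 - x 1) * v) ∧
      (x ∉ F → (q 0 - x 0) * u + (q 1 - x 1) * v ≤ 0) := by
  by_contra! hcon
  let γ : ℝ → EuclideanSpace ℝ (Fin 2) := fun t => !₂[q 0 + t * u, q 1 + t * v]
  have hpow (x : EuclideanSpace ℝ (Fin 2)) (t : ℝ) : circlePower r x (γ t) =
      circlePower r x q + t * (2 * ((q 0 - x 0) * u + (q 1 - x 1) * v) + t * (u ^ 2 + v ^ 2)) := by
    simp only [circlePower, γ, Matrix.cons_val_zero, Matrix.cons_val_one]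
    ring
  have hev : ∀ᶠ t in 𝓝[>] (0 : ℝ), ∀ x ∈ X,
      (x ∈ F → circlePower r x (γ t) ≤ 0) ∧ (x ∉ F → 0 ≤ circlePower r x (γ t)) := by
    rw [Filter.eventually_all_finset]
    intro x hx
    have hlim : Tendsto (fun t : ℝ => circlePower r x q +
        t * (2 * ((q 0 - x 0) * u + (q 1 - x 1) * v) + t * (u ^ 2 + v ^ 2))) (𝓝[>] 0)
        (𝓝 (circlePower r x q)) := by
      refine tendsto_nhdsWithin_of_tendsto_nhds ?_
      refine Continuous.tendsto' (by fun_prop) _ _ (by simp)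
    have hslope : Tendsto (fun t : ℝ => 2 * ((q 0 - x 0) * u + (q 1 - x 1) * v) +
        t * (u ^ 2 + v ^ 2)) (𝓝[>] 0) (𝓝 (2 * ((q 0 - x 0) * u + (q 1 - x 1) * v))) := by
      refine tendsto_nhdsWithin_of_tendsto_nhds ?_
      refine Continuous.tendsto' (by fun_prop) _ _ (by simp)
    simp only [hpow]
    by_cases h0 : circlePower r x q = 0
    · have hc := hcon x hx h0
      by_cases hxF : x ∈ F
      · have hneg : (q 0 - x 0) * u + (q 1 - x 1) * v < 0 := by
          by_contra! h
          exact (hc fun _ => h).1 hxF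
        filter_upwards [hslope.eventually_lt_const (show _ < (0 : ℝ) by linarith),
          self_mem_nhdsWithin] with t ht ht0
        refine ⟨fun _ => ?_, fun h => absurd hxF h⟩
        rw [h0, zero_add]
        exact mul_nonpos_of_nonneg_of_nonpos (le_of_lt ht0) ht.le
      · have hpos := (hc fun h => absurd h hxF).2
        filter_upwards [hslope.eventually_const_lt (show (0 : ℝ) < _ by linarith),
          self_mem_nhdsWithin] with t ht ht0
        refine ⟨fun h => absurd h hxF, fun _ => ?_⟩
        rw [h0, zero_add]
        exact mul_nonneg (le_of_lt ht0) ht.le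
    · by_cases hxF : x ∈ F
      · filter_upwards [hlim.eventually_lt_const (lt_of_le_of_ne ((hq.1 x hx).1 hxF) h0)]
          with t ht
        exact ⟨fun _ => ht.le, fun h => absurd hxF h⟩
      · filter_upwards [hlim.eventually_const_lt
          (lt_of_le_of_ne ((hq.1 x hx).2 hxF) (Ne.symm h0))] with t ht
        exact ⟨fun h => absurd h hxF, fun _ => ht.le⟩
  obtain ⟨t, ht, ht0⟩ := (hev.and self_mem_nhdsWithin).exists
  have hle := hq.2 (γ t) ht
  simp only [γ, Matrix.cons_val_one, Matrix.cons_val_zero] at hle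
  have : t * v < 0 := mul_neg_of_pos_of_neg ht0 hv
  linarith

/-- At a lowest point on exactly one circle, the cell has a horizontal tangent. -/
theorem IsLowest.of_unique_circle {X F : Finset (EuclideanSpace ℝ (Fin 2))} {r : ℝ}
    {q x : EuclideanSpace ℝ (Fin 2)} (hq : IsLowest X r F q)
    (huniq : ∀ y ∈ X, circlePower r y q = 0 → y = x) :
    q 0 = x 0 ∧ (x ∈ F → q 1 ≤ x 1) ∧ (x ∉ F → x 1 ≤ q 1) := by
  have key (u : ℝ) : (x ∈ F → 0 ≤ (q 0 - x 0) * u + (q 1 - x 1) * (-1)) ∧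
      (x ∉ F → (q 0 - x 0) * u + (q 1 - x 1) * (-1) ≤ 0) := by
    obtain ⟨y, hy, hy0, h⟩ := hq.exists_blocking u (-1) (by norm_num)
    rwa [huniq y hy hy0] at h
  have h0 : q 0 = x 0 := by
    by_contra hne
    have hne' : q 0 - x 0 ≠ 0 := sub_ne_zero.2 hne
    by_cases hx : x ∈ F
    · have := (key ((q 1 - x 1 - 1) / (q 0 - x 0))).1 hx
      rw [mul_div_cancel₀ _ hne'] at this
      linarith
    · have := (key ((q 1 - x 1 + 1) / (q 0 - x 0))).2 hx
      rw [mul_div_cancel₀ _ hne'] at this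
      linarith
  refine ⟨h0, fun hx => ?_, fun hx => ?_⟩
  · have := (key 0).1 hx
    linarith
  · have := (key 0).2 hx
    linarith

/-- At a lowest point on exactly two circles, the side of one circle on which the cell lies is
determined by the position of the point. -/
theorem IsLowest.of_two_circles {X F : Finset (EuclideanSpace ℝ (Fin 2))} {r : ℝ}
    {q x y : EuclideanSpace ℝ (Fin 2)} (hq : IsLowest X r F q)
    (htwo : ∀ z ∈ X, circlePower r z q = 0 → z = x ∨ z = y)
    (hdet : (q 0 - x 0) * (q 1 - y 1) - (q 1 - x 1) * (q 0 - y 0) ≠ 0) :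
    (x ∈ F → 0 ≤ (q 0 - y 0) / ((q 0 - x 0) * (q 1 - y 1) - (q 1 - x 1) * (q 0 - y 0))) ∧
    (x ∉ F → (q 0 - y 0) / ((q 0 - x 0) * (q 1 - y 1) - (q 1 - x 1) * (q 0 - y 0)) ≤ 0) := by
  set D := (q 0 - x 0) * (q 1 - y 1) - (q 1 - x 1) * (q 0 - y 0) with hD
  have hdir (A B : ℝ) (hAB : B * ((q 0 - x 0) / D) - A * ((q 0 - y 0) / D) < 0) :
      ((x ∈ F → 0 ≤ A) ∧ (x ∉ F → A ≤ 0)) ∨ ((y ∈ F → 0 ≤ B) ∧ (y ∉ F → B ≤ 0)) := by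
    obtain ⟨z, hz, hz0, h⟩ := hq.exists_blocking
      ((A * (q 1 - y 1) - B * (q 1 - x 1)) / D) _ hAB
    have hA : (q 0 - x 0) * ((A * (q 1 - y 1) - B * (q 1 - x 1)) / D) +
        (q 1 - x 1) * (B * ((q 0 - x 0) / D) - A * ((q 0 - y 0) / D)) = A := by
      field_simp
      rw [hD]
      ring
    have hB : (q 0 - y 0) * ((A * (q 1 - y 1) - B * (q 1 - x 1)) / D) +
        (q 1 - y 1) * (B * ((q 0 - x 0) / D) - A * ((q 0 - y 0) / D)) = B := by
      field_simp
      rw [hD]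
      ring
    rcases htwo z hz hz0 with rfl | rfl
    · rw [hA] at h
      exact Or.inl h
    · rw [hB] at h
      exact Or.inr h
  set α := (q 0 - y 0) / D
  set β := (q 0 - x 0) / D
  obtain ⟨B, hB⟩ : ∃ B : ℝ, ¬ ((y ∈ F → 0 ≤ B) ∧ (y ∉ F → B ≤ 0)) := by
    by_cases hy : y ∈ F
    · exact ⟨-1, fun h => by linarith [h.1 hy]⟩
    · exact ⟨1, fun h => by linarith [h.2 hy]⟩
  have habs := le_abs_self (B * β)
  have habs0 := abs_nonneg (B * β)
  constructor
  · intro hx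
    by_contra! hα
    have hA : (|B * β| + 1) / α < 0 := div_neg_of_pos_of_neg (by positivity) hα
    have := (hdir ((|B * β| + 1) / α) B (by
      rw [div_mul_cancel₀ _ hα.ne]
      linarith)).resolve_right hB
    linarith [this.1 hx]
  · intro hx
    by_contra! hα
    have hA : 0 < (|B * β| + 1) / α := by positivity
    have := (hdir ((|B * β| + 1) / α) B (by
      rw [div_mul_cancel₀ _ hα.ne']
      linarith)).resolve_right hB
    linarith [this.2 hx]

theorem GenericRadius.det_ne_zero {X : Finset (EuclideanSpace ℝ (Fin 2))} {r : ℝ}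
    (hgen : GenericRadius X r) {x y q : EuclideanSpace ℝ (Fin 2)} (hx : x ∈ X) (hy : y ∈ X)
    (hxy : x ≠ y) (hxq : circlePower r x q = 0) (hyq : circlePower r y q = 0) :
    (q 0 - x 0) * (q 1 - y 1) - (q 1 - x 1) * (q 0 - y 0) ≠ 0 := by
  intro hdet
  have htan := hgen.not_tangent x hx y hy hxy
  have hne := sq_add_sq_ne_zero_of_ne hxy
  unfold circlePower at hxq hyq
  generalize ha0 : q 0 - x 0 = a0 at *
  generalize ha1 : q 1 - x 1 = a1 at *
  generalize hb0 : q 0 - y 0 = b0 at *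
  generalize hb1 : q 1 - y 1 = b1 at *
  have h0 : x 0 - y 0 = b0 - a0 := by linarith
  have h1 : x 1 - y 1 = b1 - a1 := by linarith
  rw [h0, h1] at htan hne
  have hprod : (a0 * b0 + a1 * b1 - r ^ 2) * (a0 * b0 + a1 * b1 + r ^ 2) = 0 := by
    linear_combination (b0 ^ 2 + b1 ^ 2) * hxq + r ^ 2 * hyq - (a0 * b1 - a1 * b0) * hdet
  rcases mul_eq_zero.1 hprod with h | h
  · exact hne (by linear_combination hxq + hyq - 2 * h)
  · exact htan (by linear_combination hxq + hyq - 2 * h)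

theorem IsLowest.subset_of_generic {X F G : Finset (EuclideanSpace ℝ (Fin 2))} {r : ℝ}
    (hr : 0 < r) (hgen : GenericRadius X r) (hFX : F ⊆ X) {q : EuclideanSpace ℝ (Fin 2)}
    (hF : IsLowest X r F q) (hG : IsLowest X r G q) : F ⊆ G := by
  intro x hxF
  by_contra hxG
  have hx := hFX hxF
  have hxq : circlePower r x q = 0 := le_antisymm ((hF.1 x hx).1 hxF) ((hG.1 x hx).2 hxG)
  by_cases huniq : ∀ y ∈ X, circlePower r y q = 0 → y = x
  · obtain ⟨h0, h1, -⟩ := hF.of_unique_circle huniq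
    obtain ⟨-, -, h2⟩ := hG.of_unique_circle huniq
    have e1 : q 1 = x 1 := le_antisymm (h1 hxF) (h2 hxG)
    simp only [circlePower, h0, e1] at hxq
    nlinarith
  · push Not at huniq
    obtain ⟨y, hy, hyq, hyx⟩ := huniq
    have htwo : ∀ z ∈ X, circlePower r z q = 0 → z = x ∨ z = y := by
      intro z hz hzq
      by_contra! hne
      exact hgen.not_concurrent x hx y hy z hz hyx.symm hne.1.symm hne.2.symm q hxq hyq hzq
    have hdet := hgen.det_ne_zero hx hy hyx.symm hxq hyq
    have hzero := le_antisymm ((hG.of_two_circles htwo hdet).2 hxG)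
      ((hF.of_two_circles htwo hdet).1 hxF)
    rw [div_eq_zero_iff, or_iff_left hdet, sub_eq_zero] at hzero
    exact hgen.not_extremal y hy x hx hyx q hyq hxq hzero

/-- The point at distance `r` from `x` and `y` to the left of the line from `x` to `y`. -/
noncomputable def circleIntersection (r : ℝ) (x y : EuclideanSpace ℝ (Fin 2)) :
    EuclideanSpace ℝ (Fin 2) :=
  let s := √(r ^ 2 / ((y 0 - x 0) ^ 2 + (y 1 - x 1) ^ 2) - 1 / 4)
  !₂[(x 0 + y 0) / 2 - s * (y 1 - x 1), (x 1 + y 1) / 2 + s * (y 0 - x 0)]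

theorem eq_circleIntersection_or {r : ℝ} {x y q : EuclideanSpace ℝ (Fin 2)} (hxy : x ≠ y)
    (hxq : circlePower r x q = 0) (hyq : circlePower r y q = 0) :
    q = circleIntersection r x y ∨ q = circleIntersection r y x := by
  have hD : (y 0 - x 0) ^ 2 + (y 1 - x 1) ^ 2 ≠ 0 :=
    sq_add_sq_ne_zero_of_ne hxy.symm
  have hDsymm : (x 0 - y 0) ^ 2 + (x 1 - y 1) ^ 2 = (y 0 - x 0) ^ 2 + (y 1 - x 1) ^ 2 := by ring
  unfold circlePower at hxq hyq
  set D := (y 0 - x 0) ^ 2 + (y 1 - x 1) ^ 2 with hDdef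
  set t := ((y 0 - x 0) * (q 1 - (x 1 + y 1) / 2) - (y 1 - x 1) * (q 0 - (x 0 + y 0) / 2)) / D
    with ht
  have horth : (y 0 - x 0) * (q 0 - (x 0 + y 0) / 2) + (y 1 - x 1) * (q 1 - (x 1 + y 1) / 2)
      = 0 := by linear_combination (hxq - hyq) / 2
  have htD : t * D = (y 0 - x 0) * (q 1 - (x 1 + y 1) / 2) -
      (y 1 - x 1) * (q 0 - (x 0 + y 0) / 2) := div_mul_cancel₀ _ hD
  have hq0 : q 0 = (x 0 + y 0) / 2 - t * (y 1 - x 1) := by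
    apply mul_right_cancel₀ hD
    linear_combination (y 1 - x 1) * htD + (y 0 - x 0) * horth +
      (q 0 - (x 0 + y 0) / 2) * hDdef
  have hq1 : q 1 = (x 1 + y 1) / 2 + t * (y 0 - x 0) := by
    apply mul_right_cancel₀ hD
    linear_combination -(y 0 - x 0) * htD + (y 1 - x 1) * horth +
      (q 1 - (x 1 + y 1) / 2) * hDdef
  have htsq : r ^ 2 / D - 1 / 4 = t ^ 2 := by
    have : r ^ 2 = (t ^ 2 + 1 / 4) * D := by
      rw [hq0, hq1] at hxq
      rw [hDdef]
      linear_combination -hxq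
    rw [this, mul_div_cancel_right₀ _ hD]
    ring
  rcases le_total 0 t with h | h
  · left
    apply plane_ext
    · simp only [circleIntersection, PiLp.toLp_apply, Matrix.cons_val_zero]
      rw [← hDdef, htsq, Real.sqrt_sq h, hq0]
    · simp only [circleIntersection, PiLp.toLp_apply, Matrix.cons_val_one,
        Matrix.cons_val_zero]
      rw [← hDdef, htsq, Real.sqrt_sq h, hq1]
  · right
    apply plane_ext
    · simp only [circleIntersection, PiLp.toLp_apply, Matrix.cons_val_zero]
      rw [hDsymm, htsq, Real.sqrt_sq_eq_abs, abs_of_nonpos h, hq0]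
      ring
    · simp only [circleIntersection, PiLp.toLp_apply, Matrix.cons_val_one,
        Matrix.cons_val_zero]
      rw [hDsymm, htsq, Real.sqrt_sq_eq_abs, abs_of_nonpos h, hq1]
      ring

open Classical in
/-- The pairwise intersection points, bottoms and tops of the circles centred in `X`. -/
noncomputable def extremalPoints (X : Finset (EuclideanSpace ℝ (Fin 2))) (r : ℝ) :
    Finset (EuclideanSpace ℝ (Fin 2)) :=
  X.offDiag.image (fun z => circleIntersection r z.1 z.2) ∪
    (X.image (fun x => !₂[x 0, x 1 - r]) ∪ X.image (fun x => !₂[x 0, x 1 + r]))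

theorem card_extremalPoints_le (X : Finset (EuclideanSpace ℝ (Fin 2))) (r : ℝ) :
    (extremalPoints X r).card ≤ X.card * (X.card + 1) := by
  classical
  have hle : (extremalPoints X r).card ≤ X.offDiag.card + (X.card + X.card) := by
    unfold extremalPoints
    refine (Finset.card_union_le _ _).trans (add_le_add ?_ ((Finset.card_union_le _ _).trans
      (add_le_add ?_ ?_)))
    · convert Finset.card_image_le
    · convert Finset.card_image_le
    · convert Finset.card_image_le
  rw [Finset.offDiag_card] at hle
  have := Nat.le_mul_self X.card
  rw [mul_add, mul_one]
  omega

theorem IsLowest.mem_extremalPoints {X F : Finset (EuclideanSpace ℝ (Fin 2))} {r : ℝ}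
    {q : EuclideanSpace ℝ (Fin 2)} (hq : IsLowest X r F q) : q ∈ extremalPoints X r := by
  obtain ⟨x, hx, hxq, -⟩ := hq.exists_blocking 0 (-1) (by norm_num)
  simp only [extremalPoints, Finset.mem_union, Finset.mem_image, Finset.mem_offDiag, Prod.exists]
  by_cases huniq : ∀ y ∈ X, circlePower r y q = 0 → y = x
  · right
    have h0 := (hq.of_unique_circle huniq).1
    have h1 : (q 1 - x 1 - r) * (q 1 - x 1 + r) = 0 := by
      simp only [circlePower, h0] at hxq
      linear_combination hxq
    rcases mul_eq_zero.1 h1 with h | h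
    · exact Or.inr ⟨x, hx, plane_ext (by simp [h0]) (by simp; linarith)⟩
    · exact Or.inl ⟨x, hx, plane_ext (by simp [h0]) (by simp; linarith)⟩
  · left
    push Not at huniq
    obtain ⟨y, hy, hyq, hyx⟩ := huniq
    rcases eq_circleIntersection_or hyx.symm hxq hyq with h | h
    · exact ⟨x, y, ⟨hx, hy, hyx.symm⟩, h.symm⟩
    · exact ⟨y, x, ⟨hy, hx, hyx⟩, h.symm⟩

theorem eventually_of_subsingleton_pos {P : ℝ → Prop} {r : ℝ} (hr : 0 < r)
    (h : ∀ s t, 0 < s → 0 < t → ¬ P s → ¬ P t → s = t) : ∀ᶠ s in 𝓝[>] r, P s := by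
  have hfin : {s | 0 < s ∧ ¬ P s}.Finite :=
    Set.Subsingleton.finite fun s hs t ht => h s t hs.1 ht.1 hs.2 ht.2
  have hcof : ∀ᶠ s in 𝓝[>] r, s ∉ {s | 0 < s ∧ ¬ P s} :=
    (nhdsGT_le_nhdsNE r).trans (nhdsNE_le_cofinite r) hfin.compl_mem_cofinite
  filter_upwards [hcof, self_mem_nhdsWithin] with s hs hrs
  by_contra hP
  exact hs ⟨hr.trans hrs, hP⟩

theorem circumradius_unique {x y z p q : EuclideanSpace ℝ (Fin 2)} {s t : ℝ} (hs : 0 < s)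
    (ht : 0 < t) (hxy : x ≠ y) (hxz : x ≠ z) (hyz : y ≠ z)
    (hxp : circlePower s x p = 0) (hyp : circlePower s y p = 0) (hzp : circlePower s z p = 0)
    (hxq : circlePower t x q = 0) (hyq : circlePower t y q = 0) (hzq : circlePower t z q = 0) :
    s = t := by
  have h1 := sq_add_sq_ne_zero_of_ne hxy
  have h2 := sq_add_sq_ne_zero_of_ne hxz
  have h3 := sq_add_sq_ne_zero_of_ne hyz
  unfold circlePower at *
  by_cases hdet : (y 0 - x 0) * (z 1 - x 1) - (y 1 - x 1) * (z 0 - x 0) = 0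
  · exfalso
    have hb : 2 * ((p 0 - x 0) * (y 0 - x 0) + (p 1 - x 1) * (y 1 - x 1)) =
        (y 0 - x 0) ^ 2 + (y 1 - x 1) ^ 2 := by linear_combination hxp - hyp
    have hc : 2 * ((p 0 - x 0) * (z 0 - x 0) + (p 1 - x 1) * (z 1 - x 1)) =
        (z 0 - x 0) ^ 2 + (z 1 - x 1) ^ 2 := by linear_combination hxp - hzp
    rw [show (x 0 - y 0) ^ 2 + (x 1 - y 1) ^ 2 = (y 0 - x 0) ^ 2 + (y 1 - x 1) ^ 2 by ring] at h1
    rw [show (x 0 - z 0) ^ 2 + (x 1 - z 1) ^ 2 = (z 0 - x 0) ^ 2 + (z 1 - x 1) ^ 2 by ring] at h2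
    rw [show y 0 - z 0 = (y 0 - x 0) - (z 0 - x 0) by ring,
      show y 1 - z 1 = (y 1 - x 1) - (z 1 - x 1) by ring] at h3
    clear hxp hyp hzp hxq hyq hzq
    generalize p 0 - x 0 = a0 at *
    generalize p 1 - x 1 = a1 at *
    generalize y 0 - x 0 = b0 at *
    generalize y 1 - x 1 = b1 at *
    generalize z 0 - x 0 = c0 at *
    generalize z 1 - x 1 = c1 at *
    have hcb : c0 ^ 2 + c1 ^ 2 - (b0 * c0 + b1 * c1) = 0 := by
      apply (mul_eq_zero.1 _).resolve_right h1
      linear_combination 2 * (a1 * b0 - a0 * b1) * hdet - (b0 ^ 2 + b1 ^ 2) * hc +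
        (b0 * c0 + b1 * c1) * hb
    have hbc : b0 ^ 2 + b1 ^ 2 - (b0 * c0 + b1 * c1) = 0 := by
      apply (mul_eq_zero.1 _).resolve_right h2
      linear_combination -2 * (a1 * c0 - a0 * c1) * hdet - (c0 ^ 2 + c1 ^ 2) * hb +
        (b0 * c0 + b1 * c1) * hc
    exact h3 (by linear_combination hcb + hbc)
  · have hy' : (p 0 - q 0) * (y 0 - x 0) + (p 1 - q 1) * (y 1 - x 1) = 0 := by
      linear_combination (hxp - hyp - hxq + hyq) / 2
    have hz' : (p 0 - q 0) * (z 0 - x 0) + (p 1 - q 1) * (z 1 - x 1) = 0 := by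
      linear_combination (hxp - hzp - hxq + hzq) / 2
    have e0 : p 0 - q 0 = 0 := by
      apply (mul_eq_zero.1 _).resolve_right hdet
      linear_combination (z 1 - x 1) * hy' - (y 1 - x 1) * hz'
    have e1 : p 1 - q 1 = 0 := by
      apply (mul_eq_zero.1 _).resolve_right hdet
      linear_combination (y 0 - x 0) * hz' - (z 0 - x 0) * hy'
    have hsq : s ^ 2 = t ^ 2 := by
      linear_combination hxq - hxp + (p 0 + q 0 - 2 * x 0) * e0 + (p 1 + q 1 - 2 * x 1) * e1
    exact (sq_eq_sq₀ hs.le ht.le).1 hsq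

theorem eventually_genericRadius (X : Finset (EuclideanSpace ℝ (Fin 2))) {r : ℝ} (hr : 0 < r) :
    ∀ᶠ s in 𝓝[>] r, GenericRadius X s := by
  have htan : ∀ᶠ s in 𝓝[>] r, ∀ x ∈ X, ∀ y ∈ X, x ≠ y →
      (x 0 - y 0) ^ 2 + (x 1 - y 1) ^ 2 ≠ 4 * s ^ 2 := by
    simp only [Filter.eventually_all_finset]
    intro x _ y _
    refine eventually_of_subsingleton_pos hr fun s t hs ht hPs hPt => ?_
    push Not at hPs hPt
    exact (sq_eq_sq₀ hs.le ht.le).1 (by linarith [hPs.2, hPt.2])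
  have hext : ∀ᶠ s in 𝓝[>] r, ∀ x ∈ X, ∀ y ∈ X, x ≠ y → ∀ q, circlePower s x q = 0 →
      circlePower s y q = 0 → q 0 ≠ x 0 := by
    simp only [Filter.eventually_all_finset]
    intro x _ y _
    refine eventually_of_subsingleton_pos hr fun s t hs ht hPs hPt => ?_
    push Not at hPs hPt
    obtain ⟨hxy, p, hxp, hyp, hp⟩ := hPs
    obtain ⟨-, q, hxq, hyq, hq⟩ := hPt
    unfold circlePower at *
    rw [hp] at hxp hyp
    rw [hq] at hxq hyq
    have hp' : 2 * (p 1 - x 1) * (x 1 - y 1) = -((x 0 - y 0) ^ 2 + (x 1 - y 1) ^ 2) := by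
      linear_combination hyp - hxp
    have hq' : 2 * (q 1 - x 1) * (x 1 - y 1) = -((x 0 - y 0) ^ 2 + (x 1 - y 1) ^ 2) := by
      linear_combination hyq - hxq
    have h1 : x 1 - y 1 ≠ 0 := by
      intro h
      rw [h] at hp'
      have : x 0 - y 0 = 0 := by nlinarith
      exact hxy (plane_ext (by linarith) (by linarith))
    have hpq : p 1 = q 1 := by
      have := mul_right_cancel₀ h1 (hp'.trans hq'.symm)
      linarith
    rw [hpq] at hxp
    exact (sq_eq_sq₀ hs.le ht.le).1 (by linarith)
  have hcon : ∀ᶠ s in 𝓝[>] r, ∀ x ∈ X, ∀ y ∈ X, ∀ z ∈ X, x ≠ y → x ≠ z → y ≠ z → ∀ q,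
      circlePower s x q = 0 → circlePower s y q = 0 → circlePower s z q ≠ 0 := by
    simp only [Filter.eventually_all_finset]
    intro x _ y _ z _
    refine eventually_of_subsingleton_pos hr fun s t hs ht hPs hPt => ?_
    push Not at hPs hPt
    obtain ⟨hxy, hxz, hyz, p, hxp, hyp, hzp⟩ := hPs
    obtain ⟨-, -, -, q, hxq, hyq, hzq⟩ := hPt
    exact circumradius_unique hs ht hxy hxz hyz hxp hyp hzp hxq hyq hzq
  filter_upwards [htan, hext, hcon] with s h1 h2 h3
  exact ⟨h1, h2, h3⟩

theorem eventually_mem_diskCell (X : Finset (EuclideanSpace ℝ (Fin 2))) {r : ℝ} (hr : 0 < r)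
    (p : EuclideanSpace ℝ (Fin 2)) :
    ∀ᶠ s in 𝓝[>] r, p ∈ diskCell X s (X.filter fun x => dist x p ≤ r) := by
  simp only [diskCell, Set.mem_ofPred_eq, Filter.eventually_all_finset]
  intro x hx
  simp only [Finset.mem_filter, hx, true_and, not_le]
  rcases le_or_gt (dist x p) r with h | h
  · filter_upwards [self_mem_nhdsWithin] with s hs
    have hs' : r < s := hs
    exact ⟨fun _ => (circlePower_nonpos_iff (hr.trans hs') x p).2 (h.trans hs'.le),
      fun h' => absurd h (not_le.2 h')⟩
  · filter_upwards [self_mem_nhdsWithin, nhdsWithin_le_nhds (Iio_mem_nhds h)] with s hs hlt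
    have hs' : r < s := hs
    refine ⟨fun h' => absurd h (not_lt.2 h'), fun _ => ?_⟩
    by_contra! hneg
    exact absurd ((circlePower_nonpos_iff (hr.trans hs') x p).1 hneg.le) (not_le.2 hlt)

/-- The collection of possible positions, i.e. of nonempty subsets of a set
`X` of `n` sensor locations of the form `{x ∈ X | dist x p ≤ r}` for some
point `p` of the plane, has cardinality at most `n (n + 1)`. -/
theorem stmt_10 (n : ℕ) (X : Finset (EuclideanSpace ℝ (Fin 2))) (hX : X.card = n)
    (r : ℝ) (hr : 0 < r) :
    Set.ncard {F : Finset (EuclideanSpace ℝ (Fin 2)) |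
        F.Nonempty ∧ ∃ p : EuclideanSpace ℝ (Fin 2),
          F = X.filter (fun x => dist x p ≤ r)} ≤ n * (n + 1) := by
  set S := {F : Finset (EuclideanSpace ℝ (Fin 2)) |
        F.Nonempty ∧ ∃ p : EuclideanSpace ℝ (Fin 2),
          F = X.filter (fun x => dist x p ≤ r)} with hS
  have hsub : ∀ F ∈ S, F ⊆ X := by
    rintro F ⟨-, p, rfl⟩
    exact Finset.filter_subset _ _
  have hfin : S.Finite :=
    X.powerset.finite_toSet.subset fun F hF => Finset.mem_coe.2 (Finset.mem_powerset.2 (hsub F hF))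
  have hcells : ∀ᶠ s in 𝓝[>] r, ∀ F ∈ S, (diskCell X s F).Nonempty := by
    rw [Filter.eventually_all_finite hfin]
    rintro F ⟨-, p, rfl⟩
    exact (eventually_mem_diskCell X hr p).mono fun s hs => ⟨p, hs⟩
  obtain ⟨s, ⟨hcell, hgen⟩, hrs⟩ :=
    ((hcells.and (eventually_genericRadius X hr)).and self_mem_nhdsWithin).exists
  have hs : 0 < s := hr.trans hrs
  have hlow : ∀ F ∈ S, ∃ q, IsLowest X s F q := fun F hF =>
    exists_isLowest hs (hsub F hF) hF.1 (hcell F hF)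
  choose! f hf using hlow
  rw [← hX]
  refine le_trans ?_ (card_extremalPoints_le X s)
  rw [← Set.ncard_coe_finset]
  refine Set.ncard_le_ncard_of_injOn f (fun F hF => (hf F hF).mem_extremalPoints) ?_
    (Finset.finite_toSet _)
  intro F hF G hG hFG
  have hG' := hf G hG
  rw [← hFG] at hG'
  exact Finset.Subset.antisymm ((hf F hF).subset_of_generic hs hgen (hsub F hF) hG')
    (hG'.subset_of_generic hs hgen (hsub G hG) (hf F hF))
end
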